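/- The partition zeta function over partitions into distinct parts satisfies ζ_{𝒫*}(2) = sinh(π)/π; that is, the sum of n_λ^{−2} over all partitions λ whose parts are pairwise distinct converges to sinh(π)/π, and equivalently ∏_{n=1}^{∞} (1 + n^{−2}) = sinh(π)/π. -/

import Mathlib

/-- Partitions into distinct parts, as multisets, correspond to finite sets of naturals
through shifting every element by one. -/
noncomputable def finsetEquivDistinctPartition :
    Finset ℕ ≃ {μ : Multiset ℕ // μ.Nodup ∧ ∀ x ∈ μ, 0 < x} where
  toFun s := ⟨s.val.map (· + 1), s.nodup.map (add_left_injective 1), by simp⟩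
  invFun μ := ⟨μ.1.map (· - 1), μ.2.1.map_on fun x hx y hy h => by
    have := μ.2.2 x hx
    have := μ.2.2 y hy
    omega⟩
  left_inv s := Finset.val_injective (by simp [Multiset.map_map])
  right_inv μ := Subtype.ext <| by
    simp only [Multiset.map_map]
    conv_rhs => rw [← Multiset.map_id μ.1]
    exact Multiset.map_congr rfl fun x hx => Nat.sub_add_cancel (μ.2.2 x hx)

theorem inv_sq_prod_finsetEquivDistinctPartition (s : Finset ℕ) :
    (((finsetEquivDistinctPartition s).1.prod : ℝ) ^ 2)⁻¹ =
      ∏ n ∈ s, (((n + 1 : ℕ) : ℝ) ^ 2)⁻¹ := by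
  have h : (finsetEquivDistinctPartition s).1.prod = ∏ n ∈ s, (n + 1) := rfl
  rw [h, Nat.cast_prod, ← Finset.prod_pow, Finset.prod_inv_distrib]

/-- Euler's product for the sine, evaluated at the imaginary unit. -/
theorem tendsto_prod_one_add_inv_sq :
    Filter.Tendsto (fun N : ℕ => ∏ n ∈ Finset.range N, (1 + (((n + 1 : ℕ) : ℝ) ^ 2)⁻¹))
      Filter.atTop (nhds (Real.sinh Real.pi / Real.pi)) := by
  have hπ : (Real.pi : ℂ) ≠ 0 := Complex.ofReal_ne_zero.mpr Real.pi_ne_zero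
  have h := (Complex.tendsto_euler_sin_prod Complex.I).div_const (Real.pi * Complex.I)
  rw [Complex.sin_mul_I, mul_div_mul_right _ _ Complex.I_ne_zero] at h
  have h' : Filter.Tendsto (fun N : ℕ =>
      ((∏ n ∈ Finset.range N, (1 + (((n + 1 : ℕ) : ℝ) ^ 2)⁻¹) : ℝ) : ℂ))
      Filter.atTop (nhds ((Real.sinh Real.pi / Real.pi : ℝ) : ℂ)) := by
    rw [Complex.ofReal_div, Complex.ofReal_sinh]
    refine h.congr fun N => ?_
    rw [mul_div_cancel_left₀ _ (mul_ne_zero hπ Complex.I_ne_zero), Complex.ofReal_prod]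
    refine Finset.prod_congr rfl fun n _ => ?_
    rw [Complex.I_sq]
    push_cast
    ring
  exact Complex.continuous_re.continuousAt.tendsto.comp h'

theorem summable_inv_succ_sq : Summable fun n : ℕ => (((n + 1 : ℕ) : ℝ) ^ 2)⁻¹ :=
  (summable_nat_add_iff 1).mpr (Real.summable_nat_pow_inv.mpr one_lt_two)


/-- the sum of `n_λ^{-2}` over all partitions `λ` into distinct positive parts
(encoded as multisets with no duplicate elements) converges to `sinh(π)/π`, and equivalently
`∏_{n=1}^{∞} (1 + n^{-2}) = sinh(π)/π`. -/
theorem partitionZeta_distinct_two :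
    Summable (fun μ : {μ : Multiset ℕ // μ.Nodup ∧ ∀ x ∈ μ, 0 < x} =>
        ((μ.1.prod : ℝ) ^ 2)⁻¹) ∧
    (∑' μ : {μ : Multiset ℕ // μ.Nodup ∧ ∀ x ∈ μ, 0 < x}, ((μ.1.prod : ℝ) ^ 2)⁻¹ =
      Real.sinh Real.pi / Real.pi) ∧
    Multipliable (fun n : ℕ => 1 + (((n + 1 : ℕ) : ℝ) ^ 2)⁻¹) ∧
    (∏' n : ℕ, (1 + (((n + 1 : ℕ) : ℝ) ^ 2)⁻¹) = Real.sinh Real.pi / Real.pi) := by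
  have hs : Summable (∏ n ∈ ·, (((n + 1 : ℕ) : ℝ) ^ 2)⁻¹) :=
    summable_finsetProd_of_summable_nonneg (fun n => by positivity) summable_inv_succ_sq
  have hm := multipliable_one_add_of_summable_prod hs
  have hp := tendsto_nhds_unique hm.hasProd.tendsto_prod_nat tendsto_prod_one_add_inv_sq
  refine ⟨?_, ?_, hm, hp⟩
  · rw [← finsetEquivDistinctPartition.summable_iff]
    exact hs.congr fun s => (inv_sq_prod_finsetEquivDistinctPartition s).symm
  · rw [← finsetEquivDistinctPartition.tsum_eq, ← hp, tprod_one_add hs]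
    exact tsum_congr inv_sq_prod_finsetEquivDistinctPartition
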